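/- arXiv:quant-ph/0610193 — 5 statements merged into one kernel-verified Lean document; each statement's English description precedes it below -/
import Mathlib

section
/- Let p be a prime, ω ∈ ℂ a primitive p-th root of unity, and C₁, C₂ linear subspaces of (ZMod p)^n with C₂^⊥ ⊆ C₁. Let x, z ∈ (ZMod p)^n, let v ∈ C₁, and let h ∈ C₁^⊥. Then Z^h φ_{xzv} = ω^{x·h} φ_{xzv}, i.e., φ_{xzv} is an eigenvector of Z^h with eigenvalue ω^{x·h}. -/
open Matrix
open scoped Classical

/-- Dot product on `(ZMod p)^n`. -/
def dotp {p n : ℕ} (x y : Fin n → ZMod p) : ZMod p := ∑ i, x i * y i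

/-- The dual of a set `C ⊆ (ZMod p)^n` with respect to the dot product. -/
def dualSet {p n : ℕ} (C : Set (Fin n → ZMod p)) : Set (Fin n → ZMod p) :=
  {y | ∀ x ∈ C, dotp x y = 0}

/-- The matrix `X^u` on `ℂ^((ZMod p)^n)`: `X^u e_j = e_{j-u}`. -/
def XM (p n : ℕ) (u : Fin n → ZMod p) :
    Matrix (Fin n → ZMod p) (Fin n → ZMod p) ℂ :=
  Matrix.of fun i j => if i = j - u then 1 else 0

/-- The matrix `Z^w` on `ℂ^((ZMod p)^n)`: `Z^w e_j = ω^(w·j) e_j`, where `ω^a`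
for `a : ZMod p` is interpreted via the representative `a.val`
(well defined since `ω^p = 1`). -/
def ZM (p n : ℕ) (ω : ℂ) (w : Fin n → ZMod p) :
    Matrix (Fin n → ZMod p) (Fin n → ZMod p) ℂ :=
  Matrix.of fun i j => if i = j then ω ^ (dotp w j).val else 0

/-- The CSS codeword `φ_{xzv} = |C₂^⊥|^{-1/2} ∑_{w ∈ C₂^⊥} ω^{z·w} e_{x+v+w}`,
where `e_j` is the standard basis of `ℂ^((ZMod p)^n)`. -/
noncomputable def phi (p n : ℕ) [Fact p.Prime] (ω : ℂ)
    (C₂ : Submodule (ZMod p) (Fin n → ZMod p)) (x z v : Fin n → ZMod p) :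
    (Fin n → ZMod p) → ℂ :=
  ((Real.sqrt (Nat.card (dualSet (C₂ : Set (Fin n → ZMod p)))) : ℂ))⁻¹ •
    ∑ w : dualSet (C₂ : Set (Fin n → ZMod p)),
      ω ^ (dotp z (w : Fin n → ZMod p)).val •
        (Pi.single (x + v + (w : Fin n → ZMod p)) (1 : ℂ) : (Fin n → ZMod p) → ℂ)

theorem ZM_mulVec_apply {p n : ℕ} (ω : ℂ) (w : Fin n → ZMod p) [NeZero p]
    (f : (Fin n → ZMod p) → ℂ) (j : Fin n → ZMod p) :
    (ZM p n ω w).mulVec f j = ω ^ (dotp w j).val * f j := by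
  simp [ZM, Matrix.mulVec, dotProduct, ite_mul]

theorem ZM_mulVec_single {p n : ℕ} (ω : ℂ) (w j : Fin n → ZMod p) [NeZero p] :
    (ZM p n ω w).mulVec (Pi.single j (1 : ℂ)) =
      ω ^ (dotp w j).val • (Pi.single j (1 : ℂ) : (Fin n → ZMod p) → ℂ) := by
  ext i
  rw [ZM_mulVec_apply]
  by_cases hij : i = j
  · subst hij
    simp
  · simp [hij]

theorem dotp_comm {p n : ℕ} (x y : Fin n → ZMod p) : dotp x y = dotp y x :=
  dotProduct_comm x y

theorem dotp_add {p n : ℕ} (x y z : Fin n → ZMod p) :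
    dotp x (y + z) = dotp x y + dotp x z :=
  dotProduct_add x y z

/-- `φ_{xzv}` is an eigenvector of `Z^h` with eigenvalue `ω^{x·h}`, for
`h ∈ C₁^⊥`, when `C₂^⊥ ⊆ C₁` and `v ∈ C₁`. -/
theorem stmt8 (p n : ℕ) [Fact p.Prime] (ω : ℂ) (hω : IsPrimitiveRoot ω p)
    (C₁ C₂ : Submodule (ZMod p) (Fin n → ZMod p))
    (hcc : dualSet (C₂ : Set (Fin n → ZMod p)) ⊆ (C₁ : Set (Fin n → ZMod p)))
    (x z v : Fin n → ZMod p) (hv : v ∈ C₁)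
    (h : Fin n → ZMod p) (hh : h ∈ dualSet (C₁ : Set (Fin n → ZMod p))) :
    (ZM p n ω h).mulVec (phi p n ω C₂ x z v) =
      ω ^ (dotp x h).val • phi p n ω C₂ x z v := by
  have hdot (u : Fin n → ZMod p) (hu : u ∈ C₁) : dotp h u = 0 := by
    rw [dotp_comm]
    exact hh u hu
  simp only [phi]
  rw [Matrix.mulVec_smul, Matrix.mulVec_sum, smul_comm]
  congr 1
  rw [Finset.smul_sum]
  refine Finset.sum_congr rfl fun w _ => ?_
  rw [Matrix.mulVec_smul, ZM_mulVec_single, dotp_add, dotp_add, hdot v hv,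
    hdot w (hcc w.2), add_zero, add_zero, dotp_comm h x, smul_comm]
end

section
/- Let p be a prime, ω ∈ ℂ a primitive p-th root of unity, and C₂ a linear subspace of (ZMod p)^n. Let x, z, v ∈ (ZMod p)^n and let g ∈ C₂^⊥. Then X^g φ_{xzv} = ω^{z·g} φ_{xzv}, i.e., φ_{xzv} is an eigenvector of X^g with eigenvalue ω^{z·g}. -/
open Matrix
open scoped Classical

theorem add_mem_dualSet {p n : ℕ} {C : Set (Fin n → ZMod p)} {y z : Fin n → ZMod p}
    (hy : y ∈ dualSet C) (hz : z ∈ dualSet C) : y + z ∈ dualSet C := fun x hx => by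
  rw [dotp_add, hy x hx, hz x hx, add_zero]

theorem neg_mem_dualSet {p n : ℕ} {C : Set (Fin n → ZMod p)} {y : Fin n → ZMod p}
    (hy : y ∈ dualSet C) : -y ∈ dualSet C := fun x hx => by
  have h : dotp x (-y) = -dotp x y := by simp [dotp]
  rw [h, hy x hx, neg_zero]

/-- Translation by an element of the dual, as a permutation of the dual. -/
def dualSetAddRight {p n : ℕ} {C : Set (Fin n → ZMod p)} {g : Fin n → ZMod p}
    (hg : g ∈ dualSet C) : dualSet C ≃ dualSet C where
  toFun w := ⟨w + g, add_mem_dualSet w.2 hg⟩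
  invFun w := ⟨w + -g, add_mem_dualSet w.2 (neg_mem_dualSet hg)⟩
  left_inv w := by simp
  right_inv w := by simp

theorem XM_mulVec_single {p n : ℕ} [NeZero p] (u j : Fin n → ZMod p) :
    (XM p n u).mulVec (Pi.single j 1) = Pi.single (j - u) 1 := by
  ext i
  simp [XM, Pi.single_apply]

theorem pow_val_add {M : Type*} [Monoid M] {p : ℕ} [NeZero p] {ω : M} (hω : ω ^ p = 1)
    (a b : ZMod p) : ω ^ (a + b).val = ω ^ a.val * ω ^ b.val := by
  rw [ZMod.val_add, ← pow_add, ← pow_eq_pow_mod _ hω]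

/-- `φ_{xzv}` is an eigenvector of `X^g` with eigenvalue `ω^{z·g}`, for
`g ∈ C₂^⊥`. -/
theorem stmt9 (p n : ℕ) [Fact p.Prime] (ω : ℂ) (hω : IsPrimitiveRoot ω p)
    (C₂ : Submodule (ZMod p) (Fin n → ZMod p))
    (x z v : Fin n → ZMod p)
    (g : Fin n → ZMod p) (hg : g ∈ dualSet (C₂ : Set (Fin n → ZMod p))) :
    (XM p n g).mulVec (phi p n ω C₂ x z v) =
      ω ^ (dotp z g).val • phi p n ω C₂ x z v := by
  have hsum (w : dualSet (C₂ : Set (Fin n → ZMod p))) :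
      x + v + ((w : Fin n → ZMod p) + g) - g = x + v + w := by abel
  simp only [phi, mulVec_smul, mulVec_sum, XM_mulVec_single]
  rw [← Equiv.sum_comp (dualSetAddRight hg), smul_comm (ω ^ (dotp z g).val),
    Finset.smul_sum (r := ω ^ (dotp z g).val)]
  refine congrArg _ (Finset.sum_congr rfl fun w _ => ?_)
  simp only [dualSetAddRight, Equiv.coe_fn_mk, dotp_add, pow_val_add hω.pow_eq_one, hsum,
    smul_smul, mul_comm]
end

section
/- Let p be a prime, ω ∈ ℂ a primitive p-th root of unity, and C₁, C₂ linear subspaces of (ZMod p)^n with C₂^⊥ ⊆ C₁. Let 𝒳 ⊆ (ZMod p)^n be a complete set of coset representatives of C₁ in (ZMod p)^n, let 𝒵 ⊆ (ZMod p)^n be a complete set of coset representatives of C₂ in (ZMod p)^n, and let 𝒱 ⊆ C₁ be a complete set of coset representatives of C₂^⊥ in C₁. Then the family of vectors (φ_{xzv}) indexed by (x, z, v) ∈ 𝒳 × 𝒵 × 𝒱 is an orthonormal basis of ℂ^((ZMod p)^n) with its standard Hermitian inner product. -/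
open Matrix
open scoped Classical

/-- The dual of a linear code, as a linear code. -/
noncomputable def dualCode {p n : ℕ} [Fact p.Prime]
    (C : Submodule (ZMod p) (Fin n → ZMod p)) : Submodule (ZMod p) (Fin n → ZMod p) :=
  LinearMap.BilinForm.orthogonal (Matrix.toBilin' (1 : Matrix (Fin n) (Fin n) (ZMod p))) C

theorem sub_dotp {p n : ℕ} (x y z : Fin n → ZMod p) : dotp (x - y) z = dotp x z - dotp y z := by
  simp [dotp, sub_mul, Finset.sum_sub_distrib]

section DualCode

variable {p n : ℕ} [Fact p.Prime]

theorem toBilin'_one_apply (x y : Fin n → ZMod p) :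
    Matrix.toBilin' (1 : Matrix (Fin n) (Fin n) (ZMod p)) x y = dotp x y := by
  simp [Matrix.toBilin'_apply', dotp, dotProduct]

theorem mem_dualCode {C : Submodule (ZMod p) (Fin n → ZMod p)} {y : Fin n → ZMod p} :
    y ∈ dualCode C ↔ ∀ x ∈ C, dotp x y = 0 := by
  simp only [dualCode, LinearMap.BilinForm.mem_orthogonal_iff, toBilin'_one_apply]

theorem coe_dualCode (C : Submodule (ZMod p) (Fin n → ZMod p)) :
    (dualCode C : Set (Fin n → ZMod p)) = dualSet (C : Set (Fin n → ZMod p)) := by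
  ext y
  exact mem_dualCode

theorem nondegenerate_toBilin'_one :
    (Matrix.toBilin' (1 : Matrix (Fin n) (Fin n) (ZMod p))).Nondegenerate :=
  Matrix.nondegenerate_toBilin'_iff.2 (Matrix.nondegenerate_of_det_ne_zero (by simp))

theorem dualCode_dualCode (C : Submodule (ZMod p) (Fin n → ZMod p)) :
    dualCode (dualCode C) = C := by
  refine LinearMap.BilinForm.orthogonal_orthogonal nondegenerate_toBilin'_one ?_ C
  intro x y h
  rwa [toBilin'_one_apply, dotp_comm, ← toBilin'_one_apply]

theorem card_dualCode_mul_card (C : Submodule (ZMod p) (Fin n → ZMod p)) :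
    Nat.card (dualCode C) * Nat.card C = p ^ n := by
  have h := LinearMap.BilinForm.finrank_orthogonal (nondegenerate_toBilin'_one (p := p) (n := n)) C
  have hle := C.finrank_le
  rw [Module.finrank_fin_fun] at h hle
  rw [Module.natCard_eq_pow_finrank (K := ZMod p) (V := dualCode C),
    Module.natCard_eq_pow_finrank (K := ZMod p) (V := C), Nat.card_zmod, ← pow_add, dualCode, h,
    Nat.sub_add_cancel hle]

end DualCode

/-- The cosets of `H` in `G` partition `G`, so the size of a complete set of representatives
times the size of `H` is the size of `G`. -/
theorem card_mul_card_of_existsUnique_sub_mem {A : Type*} [AddCommGroup A]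
    (G H : AddSubgroup A) (hHG : H ≤ G) (R : Finset A) (hRG : ∀ r ∈ R, r ∈ G)
    (hR : ∀ g ∈ G, ∃! r, r ∈ R ∧ g - r ∈ H) :
    R.card * Nat.card H = Nat.card G := by
  rw [← Nat.card_eq_finsetCard, ← Nat.card_prod]
  refine Nat.card_congr (Equiv.ofBijective
    (fun q : R × H => (⟨q.1 + q.2, G.add_mem (hRG _ q.1.2) (hHG q.2.2)⟩ : G)) ⟨?_, ?_⟩)
  · rintro ⟨⟨r, hr⟩, ⟨h, hh⟩⟩ ⟨⟨s, hs⟩, ⟨k, hk⟩⟩ e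
    have e' : r + h = s + k := congrArg Subtype.val e
    have hrs : r = s := (hR (r + h) (G.add_mem (hRG _ hr) (hHG hh))).unique
      ⟨hr, by simpa using hh⟩ ⟨hs, by simpa [e'] using hk⟩
    subst hrs
    simpa using e'
  · rintro ⟨g, hg⟩
    obtain ⟨r, ⟨hr, hgr⟩, -⟩ := hR g hg
    exact ⟨(⟨r, hr⟩, ⟨g - r, hgr⟩), by simp⟩

/-- A nontrivial character of a linear code sums to zero; the characters `w ↦ ω^{u·w}` of
`C^⊥` are trivial exactly for `u ∈ C`. -/
theorem sum_dualCode_pow_dotp {p n : ℕ} [Fact p.Prime] {ω : ℂ} (hω : IsPrimitiveRoot ω p)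
    (C : Submodule (ZMod p) (Fin n → ZMod p)) (u : Fin n → ZMod p) (hu : u ∉ C) :
    ∑ w : dualCode C, ω ^ (dotp u w).val = 0 := by
  let ψ : AddChar (dualCode C) ℂ :=
    (AddChar.zmodChar p hω.pow_eq_one).compAddMonoidHom
      { toFun := fun w => dotp u w
        map_zero' := by simp [dotp]
        map_add' := fun a b => by simp [dotp_add] }
  have hψ : ψ ≠ 0 := by
    intro h
    apply hu
    rw [← dualCode_dualCode C, mem_dualCode]
    intro w hw
    have h1 : ω ^ (dotp u w).val = 1 := DFunLike.congr_fun h (⟨w, hw⟩ : dualCode C)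
    rw [dotp_comm, ← ZMod.val_eq_zero]
    exact Nat.eq_zero_of_dvd_of_lt (hω.dvd_of_pow_eq_one _ h1) (ZMod.val_lt _)
  exact AddChar.sum_eq_zero_iff_ne_zero.2 hψ

theorem conj_pow_val_mul_pow_val {p : ℕ} [Fact p.Prime] {ω : ℂ} (hω : IsPrimitiveRoot ω p)
    (a b : ZMod p) :
    (starRingEnd ℂ) (ω ^ a.val) * ω ^ b.val = ω ^ (b - a).val := by
  have h := AddChar.map_add_eq_mul (AddChar.zmodChar p hω.pow_eq_one) (-a) b
  rw [AddChar.map_neg_eq_conj] at h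
  simp only [AddChar.zmodChar_apply] at h
  rw [← h, neg_add_eq_sub]

theorem toLp_phi (p n : ℕ) [Fact p.Prime] (ω : ℂ) (C : Submodule (ZMod p) (Fin n → ZMod p))
    (x z v : Fin n → ZMod p) :
    WithLp.toLp 2 (phi p n ω C x z v) =
      ((Real.sqrt (Nat.card (dualCode C)) : ℂ))⁻¹ •
        ∑ w : dualCode C, ω ^ (dotp z w).val • EuclideanSpace.single (x + v + w) (1 : ℂ) := by
  have hcard : Nat.card (dualSet (C : Set (Fin n → ZMod p))) = Nat.card (dualCode C) := by
    rw [← coe_dualCode]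
    rfl
  rw [phi, hcard, WithLp.toLp_smul, WithLp.toLp_sum]
  congr 1
  exact Fintype.sum_equiv (Equiv.setCongr (coe_dualCode C).symm) _ _ fun _ => rfl

theorem inner_phi {p n : ℕ} [Fact p.Prime] {ω : ℂ} (hω : IsPrimitiveRoot ω p)
    (C : Submodule (ZMod p) (Fin n → ZMod p)) (x z v x' z' v' : Fin n → ZMod p) :
    inner ℂ (WithLp.toLp 2 (phi p n ω C x z v)) (WithLp.toLp 2 (phi p n ω C x' z' v')) =
      (Nat.card (dualCode C) : ℂ)⁻¹ * ∑ w : dualCode C, ∑ w' : dualCode C,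
        if x + v + w = x' + v' + w' then ω ^ (dotp z' w' - dotp z w).val else 0 := by
  have hc : ((Real.sqrt (Nat.card (dualCode C)) : ℂ))⁻¹ *
      ((Real.sqrt (Nat.card (dualCode C)) : ℂ))⁻¹ = (Nat.card (dualCode C) : ℂ)⁻¹ := by
    rw [← mul_inv, ← Complex.ofReal_mul, Real.mul_self_sqrt (Nat.cast_nonneg _),
      Complex.ofReal_natCast]
  rw [toLp_phi, toLp_phi, inner_smul_left, inner_smul_right, map_inv₀, Complex.conj_ofReal,
    ← mul_assoc, hc, sum_inner]
  simp only [inner_sum, inner_smul_left, inner_smul_right, EuclideanSpace.inner_single_left,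
    map_one, one_mul, PiLp.single_apply]
  congr 1
  refine Finset.sum_congr rfl fun w _ => Finset.sum_congr rfl fun w' _ => ?_
  split_ifs with h
  · rw [mul_one, mul_comm, conj_pow_val_mul_pow_val hω]
  · simp

/-- If `𝒳`, `𝒵`, `𝒱` are complete sets of coset representatives of
`(ZMod p)^n / C₁`, `(ZMod p)^n / C₂` and `C₁ / C₂^⊥` respectively
(with `C₂^⊥ ⊆ C₁`), then the family `(φ_{xzv})_{(x,z,v) ∈ 𝒳 × 𝒵 × 𝒱}`
is an orthonormal basis of `ℂ^((ZMod p)^n)` with its standard Hermitian inner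
product. -/
theorem stmt10 (p n : ℕ) [Fact p.Prime] (ω : ℂ) (hω : IsPrimitiveRoot ω p)
    (C₁ C₂ : Submodule (ZMod p) (Fin n → ZMod p))
    (hcc : dualSet (C₂ : Set (Fin n → ZMod p)) ⊆ (C₁ : Set (Fin n → ZMod p)))
    (𝒳 𝒵 𝒱 : Finset (Fin n → ZMod p))
    (hX : ∀ y : Fin n → ZMod p, ∃! x, x ∈ 𝒳 ∧ y - x ∈ C₁)
    (hZ : ∀ y : Fin n → ZMod p, ∃! z, z ∈ 𝒵 ∧ y - z ∈ C₂)
    (hV₁ : ∀ v ∈ 𝒱, v ∈ C₁)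
    (hV₂ : ∀ c ∈ C₁, ∃! v, v ∈ 𝒱 ∧ c - v ∈ dualSet (C₂ : Set (Fin n → ZMod p))) :
    ∃ B : OrthonormalBasis (↥𝒳 × ↥𝒵 × ↥𝒱) ℂ
        (EuclideanSpace ℂ (Fin n → ZMod p)),
      ∀ (x : 𝒳) (z : 𝒵) (v : 𝒱),
        B ⟨x, z, v⟩ =
          (WithLp.equiv 2 ((Fin n → ZMod p) → ℂ)).symm
            (phi p n ω C₂ (x : Fin n → ZMod p) (z : Fin n → ZMod p)
              (v : Fin n → ZMod p)) := by
  have hD := coe_dualCode C₂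
  simp only [← hD] at hcc hV₂
  have hDC : dualCode C₂ ≤ C₁ := hcc
  have hXV : 𝒱.card * Nat.card (dualCode C₂) = Nat.card C₁ :=
    card_mul_card_of_existsUnique_sub_mem C₁.toAddSubgroup (dualCode C₂).toAddSubgroup
      hDC 𝒱 hV₁ hV₂
  have hX' : 𝒳.card * Nat.card C₁ = p ^ n := by
    simpa using card_mul_card_of_existsUnique_sub_mem ⊤ C₁.toAddSubgroup le_top 𝒳
      (fun _ _ => trivial) (fun y _ => hX y)
  have hZ' : 𝒵.card * Nat.card C₂ = p ^ n := by
    simpa using card_mul_card_of_existsUnique_sub_mem ⊤ C₂.toAddSubgroup le_top 𝒵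
      (fun _ _ => trivial) (fun y _ => hZ y)
  have hZD : 𝒵.card = Nat.card (dualCode C₂) :=
    Nat.eq_of_mul_eq_mul_right Nat.card_pos (hZ'.trans (card_dualCode_mul_card C₂).symm)
  have hcard : Fintype.card (𝒳 × 𝒵 × 𝒱) =
      Module.finrank ℂ (EuclideanSpace ℂ (Fin n → ZMod p)) := by
    simp only [Fintype.card_prod, Fintype.card_coe, finrank_euclideanSpace, Fintype.card_fun,
      ZMod.card, Fintype.card_fin]
    rw [hZD, mul_comm (Nat.card _), hXV, hX']
  let f : 𝒳 × 𝒵 × 𝒱 → EuclideanSpace ℂ (Fin n → ZMod p) :=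
    fun i => WithLp.toLp 2 (phi p n ω C₂ i.1 i.2.1 i.2.2)
  have hf : Orthonormal ℂ f := by
    rw [orthonormal_iff_ite]
    rintro ⟨⟨x, hx⟩, ⟨z, hz⟩, ⟨v, hv⟩⟩ ⟨⟨x', hx'⟩, ⟨z', hz'⟩, ⟨v', hv'⟩⟩
    simp only [f, inner_phi hω, Prod.mk.injEq, Subtype.mk.injEq]
    by_cases hxv : x = x' ∧ v = v'
    · obtain ⟨rfl, rfl⟩ := hxv
      simp only [add_right_inj, Subtype.coe_inj, Finset.sum_ite_eq, Finset.mem_univ, if_true,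
        true_and, and_true, ← sub_dotp]
      split_ifs with hzz
      · subst hzz
        simp [dotp]
      · rw [sum_dualCode_pow_dotp hω, mul_zero]
        intro h
        exact hzz ((hZ z').unique ⟨hz, h⟩ ⟨hz', by simp⟩)
    · rw [if_neg (fun h => hxv ⟨h.1, h.2.2⟩)]
      refine mul_eq_zero_of_right _ (Finset.sum_eq_zero fun w _ => Finset.sum_eq_zero fun w' _ =>
        if_neg fun h => hxv ?_)
      have hxx : x = x' := by
        refine (hX (x + v + w)).unique ⟨hx, ?_⟩ ⟨hx', ?_⟩
        · rw [add_assoc, add_sub_cancel_left]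
          exact C₁.add_mem (hV₁ v hv) (hDC w.2)
        · rw [h, add_assoc, add_sub_cancel_left]
          exact C₁.add_mem (hV₁ v' hv') (hDC w'.2)
      subst hxx
      rw [add_assoc, add_assoc, add_right_inj] at h
      refine ⟨rfl, (hV₂ (v + w) (C₁.add_mem (hV₁ v hv) (hDC w.2))).unique ⟨hv, ?_⟩ ⟨hv', ?_⟩⟩
      · simp
      · simp [h]
  refine ⟨OrthonormalBasis.mk hf (hf.linearIndependent.span_eq_top_of_card_eq_finrank' hcard).ge,
    fun x z v => ?_⟩
  rw [OrthonormalBasis.coe_mk]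
  rfl
end

section
/- Let p be a prime, ω ∈ ℂ a primitive p-th root of unity, and C₂ a linear subspace of (ZMod p)^n. Let x, v ∈ (ZMod p)^n be fixed and let 𝒵 ⊆ (ZMod p)^n be a complete set of coset representatives of C₂ in (ZMod p)^n. Then (1/|𝒵|) Σ_{z ∈ 𝒵} |φ_{xzv}⟩⟨φ_{xzv}| = (1/|C₂^⊥|) Σ_{w ∈ C₂^⊥} |e_{x+v+w}⟩⟨e_{x+v+w}|, where |ψ⟩⟨ψ| denotes the matrix whose (i,j) entry is ψᵢ · conj(ψⱼ). -/
open Matrix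
open scoped Classical

/-- The rank-one matrix `|ψ⟩⟨ψ|`, whose `(i,j)` entry is `ψ i * conj (ψ j)`. -/
noncomputable def outer {p n : ℕ} (ψ : (Fin n → ZMod p) → ℂ) :
    Matrix (Fin n → ZMod p) (Fin n → ZMod p) ℂ :=
  Matrix.of fun i j => ψ i * (starRingEnd ℂ) (ψ j)

theorem dotp_add_left {p n : ℕ} (x y d : Fin n → ZMod p) :
    dotp (x + y) d = dotp x d + dotp y d := by
  simp [dotp, add_mul, Finset.sum_add_distrib]

theorem dotp_sub_left {p n : ℕ} (x y d : Fin n → ZMod p) :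
    dotp (x - y) d = dotp x d - dotp y d := by
  simp [dotp, sub_mul, Finset.sum_sub_distrib]

theorem dotp_sub_right {p n : ℕ} (x d e : Fin n → ZMod p) :
    dotp x (d - e) = dotp x d - dotp x e := by
  simp [dotp, mul_sub, Finset.sum_sub_distrib]

theorem sub_mem_dualSet {p n : ℕ} {C : Set (Fin n → ZMod p)} {d e : Fin n → ZMod p}
    (hd : d ∈ dualSet C) (he : e ∈ dualSet C) : d - e ∈ dualSet C := by
  intro x hx
  rw [dotp_sub_right, hd x hx, he x hx, sub_zero]

/-- The sum of a nontrivial character `z ↦ χ (z · d)`, `d ∈ C^⊥`, over a complete set of coset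
representatives of `C` vanishes. -/
theorem sum_addChar_dotp_eq_zero {p n : ℕ} [Fact p.Prime] {χ : AddChar (ZMod p) ℂ}
    (hχ : χ.IsPrimitive) {C : Submodule (ZMod p) (Fin n → ZMod p)}
    {Z : Finset (Fin n → ZMod p)} (hZ : ∀ y, ∃! z, z ∈ Z ∧ y - z ∈ C)
    {d : Fin n → ZMod p} (hd : d ∈ dualSet (C : Set (Fin n → ZMod p))) (hd0 : d ≠ 0) :
    ∑ z ∈ Z, χ (dotp z d) = 0 := by
  obtain ⟨k, hk⟩ := Function.ne_iff.mp hd0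
  obtain ⟨a, ha⟩ := AddChar.ne_one_iff.mp (hχ hk)
  set y : Fin n → ZMod p := Pi.single k a
  have hy : χ (dotp y d) ≠ 1 := by
    have : dotp y d = d k * a := by simp [dotp, y, Pi.single_apply, mul_comm]
    rwa [this]
  choose r hr hr_unique using hZ
  have hr_dotp (u) : dotp (r u) d = dotp u d := by
    have h := hd _ (hr u).2
    rw [dotp_sub_left] at h
    exact (sub_eq_zero.mp h).symm
  have h_shift : ∑ z ∈ Z, χ (dotp y d) * χ (dotp z d) = ∑ z ∈ Z, χ (dotp z d) := by
    refine Finset.sum_nbij' (fun z => r (z + y)) (fun z => r (z - y))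
      (fun z _ => (hr _).1) (fun z _ => (hr _).1) ?_ ?_ ?_
    · intro z hz
      refine (hr_unique _ z ⟨hz, ?_⟩).symm
      have h := C.neg_mem (hr (z + y)).2
      convert h using 1
      abel
    · intro z hz
      refine (hr_unique _ z ⟨hz, ?_⟩).symm
      have h := C.neg_mem (hr (z - y)).2
      convert h using 1
      abel
    · intro z _
      rw [hr_dotp, dotp_add_left, AddChar.map_add_eq_mul, mul_comm]
  rw [← Finset.mul_sum] at h_shift
  by_contra h
  exact hy (mul_right_cancel₀ h (h_shift.trans (one_mul _).symm))

theorem phi_apply {p n : ℕ} [Fact p.Prime] {ω : ℂ} (hω : ω ^ p = 1)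
    (C : Submodule (ZMod p) (Fin n → ZMod p)) (x z v i : Fin n → ZMod p) :
    phi p n ω C x z v i =
      ((Real.sqrt (Nat.card (dualSet (C : Set (Fin n → ZMod p)))) : ℂ))⁻¹ *
        if i - (x + v) ∈ dualSet (C : Set (Fin n → ZMod p)) then
          AddChar.zmodChar p hω (dotp z (i - (x + v))) else 0 := by
  simp only [phi, Pi.smul_apply, Finset.sum_apply, smul_eq_mul]
  congr 1
  split_ifs with h
  · rw [Finset.sum_eq_single ⟨i - (x + v), h⟩]
    · simp [AddChar.zmodChar_apply]
    · intro w _ hw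
      rw [Pi.single_eq_of_ne, mul_zero]
      rintro rfl
      exact hw (Subtype.ext (by simp))
    · simp
  · refine Finset.sum_eq_zero fun w _ => ?_
    rw [Pi.single_eq_of_ne, mul_zero]
    rintro rfl
    exact h (by simp)

theorem sum_outer_single_apply {p n : ℕ} [Fact p.Prime] (D : Set (Fin n → ZMod p))
    (a i j : Fin n → ZMod p) :
    (∑ w : D, outer (Pi.single (a + (w : Fin n → ZMod p)) (1 : ℂ))) i j =
      if i = j ∧ i - a ∈ D then 1 else 0 := by
  rw [Matrix.sum_apply]
  split_ifs with h
  · obtain ⟨rfl, h⟩ := h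
    rw [Finset.sum_eq_single ⟨i - a, h⟩]
    · simp [outer]
    · intro w _ hw
      have : i ≠ a + w := by
        rintro rfl
        exact hw (Subtype.ext (by simp))
      simp [outer, Pi.single_eq_of_ne this]
    · simp
  · refine Finset.sum_eq_zero fun w _ => ?_
    by_cases hi : i = a + w
    · have hj : j ≠ a + w := by
        rintro rfl
        exact h ⟨hi, by simp [hi]⟩
      simp [outer, Pi.single_eq_of_ne hj]
    · simp [outer, Pi.single_eq_of_ne hi]

/-- Averaging the projectors `|φ_{xzv}⟩⟨φ_{xzv}|` over a complete set `𝒵` of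
coset representatives of `C₂` yields the uniform mixture of the standard basis
projectors `|e_{x+v+w}⟩⟨e_{x+v+w}|`, `w ∈ C₂^⊥`. -/
theorem stmt11 (p n : ℕ) [Fact p.Prime] (ω : ℂ) (hω : IsPrimitiveRoot ω p)
    (C₂ : Submodule (ZMod p) (Fin n → ZMod p))
    (x v : Fin n → ZMod p)
    (𝒵 : Finset (Fin n → ZMod p))
    (hZ : ∀ y : Fin n → ZMod p, ∃! z, z ∈ 𝒵 ∧ y - z ∈ C₂) :
    ((𝒵.card : ℂ))⁻¹ • ∑ z ∈ 𝒵, outer (phi p n ω C₂ x z v) =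
      ((Nat.card (dualSet (C₂ : Set (Fin n → ZMod p))) : ℂ))⁻¹ •
        ∑ w : dualSet (C₂ : Set (Fin n → ZMod p)),
          outer (Pi.single (x + v + (w : Fin n → ZMod p)) (1 : ℂ)) := by
  set χ := AddChar.zmodChar p hω.pow_eq_one with hχ_def
  have hχ : χ.IsPrimitive := AddChar.zmodChar_primitive_of_primitive_root p hω
  set D := dualSet (C₂ : Set (Fin n → ZMod p)) with hD
  have hZ0 : (𝒵.card : ℂ) ≠ 0 := by
    obtain ⟨z, hz, -⟩ := (hZ 0).exists
    exact_mod_cast (Finset.card_pos.mpr ⟨z, hz⟩).ne'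
  have h_sqrt : ((Real.sqrt (Nat.card D) : ℂ))⁻¹ * ((Real.sqrt (Nat.card D) : ℂ))⁻¹ =
      (Nat.card D : ℂ)⁻¹ := by
    rw [← mul_inv, ← Complex.ofReal_mul, Real.mul_self_sqrt (Nat.cast_nonneg _),
      Complex.ofReal_natCast]
  have h_entry (z i j) : outer (phi p n ω C₂ x z v) i j = (Nat.card D : ℂ)⁻¹ *
      if i - (x + v) ∈ D ∧ j - (x + v) ∈ D then χ (dotp z (i - j)) else 0 := by
    have h_sub : dotp z (i - j) = dotp z (i - (x + v)) + -dotp z (j - (x + v)) := by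
      rw [← sub_eq_add_neg, ← dotp_sub_right, sub_sub_sub_cancel_right]
    rw [outer, Matrix.of_apply, phi_apply hω.pow_eq_one, phi_apply hω.pow_eq_one,
      h_sub, AddChar.map_add_eq_mul, AddChar.map_neg_eq_conj, ← h_sqrt, ← hχ_def, ← hD,
      map_mul, map_inv₀, Complex.conj_ofReal]
    by_cases hi : i - (x + v) ∈ D <;> by_cases hj : j - (x + v) ∈ D <;> simp [hi, hj]
    ring
  ext i j
  rw [Matrix.smul_apply, Matrix.smul_apply, sum_outer_single_apply, Matrix.sum_apply]
  simp only [h_entry, smul_eq_mul, ← Finset.mul_sum]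
  rw [mul_left_comm]
  congr 1
  by_cases hij : i - (x + v) ∈ D ∧ j - (x + v) ∈ D
  · simp only [hij, and_self, if_true, and_true]
    split_ifs with h
    · subst h
      simp [dotp, hZ0]
    · have hd := sub_mem_dualSet hij.1 hij.2
      rw [sub_sub_sub_cancel_right] at hd
      rw [sum_addChar_dotp_eq_zero hχ hZ hd (sub_ne_zero.mpr h), mul_zero]
  · have h : ¬(i = j ∧ i - (x + v) ∈ D) := by
      rintro ⟨rfl, h⟩
      exact hij ⟨h, h⟩
    simp [hij, h]
end

section
/- Let p be a prime, K = 𝔽_{p^m} a finite field extension of 𝔽_p, and C a K-linear subspace of K^n. Then {y ∈ K^n : ∀x ∈ C, Tr_{K/𝔽_p}(x·y) = 0} = C^⊥, where x·y = Σⱼ xⱼyⱼ is the dot product over K and C^⊥ = {y ∈ K^n : ∀x ∈ C, x·y = 0}. -/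
/-- For a `K`-linear subspace `C` of `K^n`, where `K = 𝔽_{p^m}` is a finite
extension of `𝔽_p`, the "trace dual"
`{y : ∀ x ∈ C, Tr_{K/𝔽_p}(x·y) = 0}` coincides with the ordinary dual
`C^⊥ = {y : ∀ x ∈ C, x·y = 0}`. -/
theorem stmt17 (p m n : ℕ) [Fact p.Prime]
    (K : Type*) [Field K] [Fintype K] [Algebra (ZMod p) K]
    (hcard : Fintype.card K = p ^ m)
    (C : Submodule K (Fin n → K)) :
    {y : Fin n → K | ∀ x ∈ C, Algebra.trace (ZMod p) K (∑ j, x j * y j) = 0} =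
      {y : Fin n → K | ∀ x ∈ C, ∑ j, x j * y j = 0} := by
  ext y
  refine ⟨fun h x hx => ?_, fun h x hx => by rw [h x hx, map_zero]⟩
  refine (traceForm_nondegenerate (ZMod p) K).1 _ fun a => ?_
  have hax := h (a • x) (C.smul_mem a hx)
  rw [Algebra.traceForm_apply, mul_comm, Finset.mul_sum]
  simpa only [Pi.smul_apply, smul_eq_mul, mul_assoc] using hax
end
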